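/- Let n ≥ 1 and let Z be a topological space homeomorphic to the even-dimensional sphere S^{2n}, and let Φ : Z × [0,∞) → Z be a continuous semiflow. Then Φ has a fixed point, i.e. there exists z ∈ Z with Φ(z,t) = z for all t ≥ 0. -/

import Mathlib

open scoped NNReal
open Filter Topology

/-- A polynomial cannot agree near infinity with an odd power of `√(s ^ 2 + 1)`. -/
theorem Polynomial.even_of_eval_eq_mul_sqrt_pow {p : Polynomial ℝ} {L c : ℝ} {d : ℕ} (hc : c ≠ 0)
    (h : ∀ s > L, p.eval s = c * √(s ^ 2 + 1) ^ d) : Even d := by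
  have hsq : p ^ 2 = C (c ^ 2) * (X ^ 2 + 1) ^ d := by
    refine Polynomial.eq_of_infinite_eval_eq _ _ ((Set.Ioi_infinite L).mono fun s hs => ?_)
    have : √(s ^ 2 + 1) ^ 2 = s ^ 2 + 1 := Real.sq_sqrt (by positivity)
    simp only [Set.mem_ofPred_eq, eval_pow, eval_mul, eval_C, eval_add, eval_X, eval_one, h s hs]
    rw [mul_pow, ← pow_mul, mul_comm d, pow_mul, this]
  have hsq' := congrArg (Polynomial.map (algebraMap ℝ ℂ)) hsq
  have hfac : (X ^ 2 + 1 : Polynomial ℂ) = (X - C Complex.I) * (X - C (-Complex.I)) := by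
    have : (C Complex.I * C Complex.I : Polynomial ℂ) = -1 := by
      rw [← C_mul, Complex.I_mul_I]; simp
    simp only [C_neg]
    linear_combination this
  have hroot := congrArg (Polynomial.rootMultiplicity Complex.I) hsq'
  simp only [Polynomial.map_pow, Polynomial.map_mul, Polynomial.map_C, Polynomial.map_add,
    Polynomial.map_X, Polynomial.map_one] at hroot hsq'
  have hc' : (C (algebraMap ℝ ℂ (c ^ 2)) : Polynomial ℂ) ≠ 0 := by simpa using hc
  have hX : (X ^ 2 + 1 : Polynomial ℂ) ≠ 0 := by
    rw [hfac]; exact mul_ne_zero (X_sub_C_ne_zero _) (X_sub_C_ne_zero _)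
  have hI : Complex.I ≠ -Complex.I := by
    intro h; have := congrArg Complex.im h; norm_num at this
  have h1 : (X ^ 2 + 1 : Polynomial ℂ).rootMultiplicity Complex.I = 1 := by
    rw [hfac, rootMultiplicity_mul (hfac ▸ hX), rootMultiplicity_X_sub_C_self,
      rootMultiplicity_X_sub_C]
    simp [hI]
  have key (q : Polynomial ℂ) (k : ℕ) :
      (q ^ k).rootMultiplicity Complex.I = k * q.rootMultiplicity Complex.I := by
    rw [← count_roots, roots_pow, Multiset.count_nsmul, count_roots]
  rw [key, rootMultiplicity_mul (mul_ne_zero hc' (pow_ne_zero _ hX)), key, h1,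
    rootMultiplicity_C] at hroot
  exact ⟨(p.map (algebraMap ℝ ℂ)).rootMultiplicity Complex.I, by linarith⟩

open MeasureTheory in
/-- Integrating a family of polynomials of bounded degree gives a polynomial. -/
theorem MeasureTheory.exists_polynomial_eval_eq_integral {α : Type*} [MeasurableSpace α]
    {μ : Measure α} {P : α → Polynomial ℝ} {d : ℕ} {L : ℝ} (hd : ∀ x, (P x).natDegree ≤ d)
    (hint : ∀ s > L, Integrable (fun x => (P x).eval s) μ) :
    ∃ p : Polynomial ℝ, ∀ s > L, p.eval s = ∫ x, (P x).eval s ∂μ := by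
  let v : ℕ → ℝ := fun i => L + 1 + i
  have hv : ∀ i, L < v i := fun i => by
    have : (0 : ℝ) ≤ i := i.cast_nonneg
    simp only [v]; linarith
  have hinj : Set.InjOn v (Finset.range (d + 1)) := fun i _ j _ h => by simpa [v] using h
  refine ⟨Lagrange.interpolate (Finset.range (d + 1)) v fun i => ∫ x, (P x).eval (v i) ∂μ,
    fun s _ => ?_⟩
  have hP (x : α) : (P x).eval s = ∑ i ∈ Finset.range (d + 1),
      (P x).eval (v i) * (Lagrange.basis (Finset.range (d + 1)) v i).eval s := by
    conv_lhs => rw [Lagrange.eq_interpolate (f := P x) hinj (by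
      rw [Finset.card_range]
      exact Polynomial.degree_le_natDegree.trans_lt (by exact_mod_cast Nat.lt_succ_of_le (hd x)))]
    simp [Lagrange.interpolate_apply, Polynomial.eval_finsetSum]
  simp_rw [hP]
  rw [integral_finsetSum _ fun i _ => (hint _ (hv i)).mul_const _]
  simp [Lagrange.interpolate_apply, Polynomial.eval_finsetSum, integral_mul_const]

/-- `det (s - A)` is positive when `s` exceeds the norm of `A`. -/
theorem ContinuousLinearMap.charpoly_eval_pos {E : Type*} [NormedAddCommGroup E] [NormedSpace ℝ E]
    [FiniteDimensional ℝ E] (A : E →L[ℝ] E) {s : ℝ} (hs : ‖A‖ < s) :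
    0 < (A : E →ₗ[ℝ] E).charpoly.eval s := by
  set p := (A : E →ₗ[ℝ] E).charpoly with hp
  have hne : ∀ r, ‖A‖ < r → p.eval r ≠ 0 := by
    intro r hr h0
    rw [hp, LinearMap.eval_charpoly] at h0
    obtain ⟨x, hx, hx0⟩ := Submodule.exists_mem_ne_zero_of_ne_bot
      (LinearMap.bot_lt_ker_of_det_eq_zero h0).ne'
    have hAx : A x = r • x := by
      have := LinearMap.mem_ker.1 hx
      exact (sub_eq_zero.1 (by simpa using this)).symm
    have h1 := A.le_opNorm x
    rw [hAx, norm_smul, Real.norm_of_nonneg ((norm_nonneg A).trans hr.le)] at h1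
    exact absurd (le_of_mul_le_mul_right h1 (norm_pos_iff.2 hx0)) hr.not_ge
  have hmonic : p.Monic := LinearMap.charpoly_monic _
  obtain ⟨T, hT, hTs⟩ : ∃ T, 0 < p.eval T ∧ s ≤ T := by
    by_cases hdeg : 0 < p.degree
    · have := p.tendsto_atTop_of_leadingCoeff_nonneg hdeg (by simp [hmonic.leadingCoeff])
      exact ((this.eventually_gt_atTop 0).and (eventually_ge_atTop s)).exists
    · have : p = 1 := hmonic.natDegree_eq_zero.1 (by
        rw [not_lt] at hdeg; exact Polynomial.natDegree_eq_zero_iff_degree_le_zero.2 hdeg)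
      exact ⟨s, by simp [this], le_rfl⟩
  by_contra! hneg
  obtain ⟨r, hr, hr0⟩ := intermediate_value_Icc hTs p.continuous.continuousOn ⟨hneg, hT.le⟩
  exact hne r (hs.trans_le hr.1) hr0

section Sphere

variable {E : Type*} [NormedAddCommGroup E] [InnerProductSpace ℝ E]

/-- If `y` is orthogonal to `x` and as long as `x`, then `s • x - y` has norm `√(s ^ 2 + 1) * ‖x‖`. -/
theorem norm_smul_sub_of_inner_eq_zero {x y : E} (hxy : inner ℝ x y = 0) (hnorm : ‖y‖ = ‖x‖)
    (s : ℝ) : ‖s • x - y‖ = √(s ^ 2 + 1) * ‖x‖ := by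
  have h : ‖s • x - y‖ ^ 2 = (√(s ^ 2 + 1) * ‖x‖) ^ 2 := by
    rw [norm_sub_sq_real, inner_smul_left, hxy, mul_pow, Real.sq_sqrt (by positivity), norm_smul,
      hnorm, mul_pow, Real.norm_eq_abs, sq_abs]
    simp
    ring
  exact (sq_eq_sq₀ (norm_nonneg _) (by positivity)).1 h

theorem LipschitzWith.bijective_smul_sub [CompleteSpace E] {w : E → E} {L : ℝ≥0}
    (hw : LipschitzWith L w) {s : ℝ} (hs : (L : ℝ) < s) :
    Function.Bijective fun x => s • x - w x := by
  have hs0 : 0 < s := L.coe_nonneg.trans_lt hs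
  constructor
  · intro x y hxy
    have h1 : s • (x - y) = w x - w y := by
      rw [smul_sub, sub_eq_sub_iff_sub_eq_sub]; exact hxy
    have h2 := hw.norm_sub_le x y
    rw [← h1, norm_smul, Real.norm_of_nonneg hs0.le] at h2
    by_contra hne
    exact absurd (le_of_mul_le_mul_right h2 (norm_pos_iff.2 (sub_ne_zero.2 hne))) hs.not_ge
  · intro y
    have hcontr : ContractingWith (L / s.toNNReal) fun x => s⁻¹ • (y + w x) := by
      refine ⟨?_, LipschitzWith.of_dist_le_mul fun a b => ?_⟩
      · rw [div_lt_one (by simpa using hs0)]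
        exact (Real.lt_toNNReal_iff_coe_lt).2 hs
      · rw [dist_smul₀, dist_add_left, Real.norm_of_nonneg (by positivity), NNReal.coe_div,
          Real.coe_toNNReal _ hs0.le, div_eq_inv_mul, mul_assoc]
        gcongr
        exact hw.dist_le_mul a b
    refine ⟨hcontr.fixedPoint _, ?_⟩
    have h := hcontr.fixedPoint_isFixedPt
    set x := hcontr.fixedPoint _
    have h' : s⁻¹ • (y + w x) = x := h
    have : s • x = y + w x := by
      conv_lhs => rw [← h']
      rw [smul_inv_smul₀ hs0.ne']
    simp [this]

/-- Rescaling a Lipschitz map on the unit sphere radially gives a Lipschitz map. -/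
theorem LipschitzOnWith.norm_smul_normalize {u : E → E} {K : ℝ≥0}
    (hu : LipschitzOnWith K u (Metric.sphere 0 1))
    (hnorm : ∀ x ∈ Metric.sphere (0 : E) 1, ‖u x‖ = 1) :
    LipschitzWith (2 * K + 1) fun x => ‖x‖ • u (‖x‖⁻¹ • x) := by
  have hsph {x : E} (hx : x ≠ 0) : ‖x‖⁻¹ • x ∈ Metric.sphere (0 : E) 1 := by
    simp [norm_smul, hx]
  have hnorm' (x : E) : ‖‖x‖ • u (‖x‖⁻¹ • x)‖ = ‖x‖ := by
    rcases eq_or_ne x 0 with rfl | hx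
    · simp
    · rw [norm_smul, hnorm _ (hsph hx), norm_norm, mul_one]
  refine LipschitzWith.of_dist_le_mul fun x y => ?_
  rw [dist_eq_norm, dist_eq_norm]
  rcases eq_or_ne x 0 with rfl | hx
  · simp only [norm_zero, zero_smul, zero_sub, norm_neg, hnorm']
    push_cast
    nlinarith [norm_nonneg y, K.coe_nonneg, mul_nonneg K.coe_nonneg (norm_nonneg y)]
  rcases eq_or_ne y 0 with rfl | hy
  · simp only [norm_zero, zero_smul, sub_zero, hnorm']
    push_cast
    nlinarith [norm_nonneg x, K.coe_nonneg, mul_nonneg K.coe_nonneg (norm_nonneg x)]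
  have hx0 := norm_pos_iff.2 hx
  have hy0 := norm_pos_iff.2 hy
  have habs : |‖x‖ - ‖y‖| ≤ ‖x - y‖ := abs_norm_sub_norm_le x y
  have h1 : ‖x‖ * ‖‖x‖⁻¹ • x - ‖y‖⁻¹ • y‖ ≤ 2 * ‖x - y‖ := by
    have : ‖x‖ • (‖x‖⁻¹ • x - ‖y‖⁻¹ • y) = (x - y) - ((‖x‖ - ‖y‖) * ‖y‖⁻¹) • y := by
      rw [smul_sub, smul_inv_smul₀ hx0.ne', smul_smul, sub_mul, mul_inv_cancel₀ hy0.ne', sub_smul,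
        one_smul]
      abel
    calc ‖x‖ * ‖‖x‖⁻¹ • x - ‖y‖⁻¹ • y‖ = ‖‖x‖ • (‖x‖⁻¹ • x - ‖y‖⁻¹ • y)‖ := by
          rw [norm_smul, norm_norm]
      _ ≤ ‖x - y‖ + ‖((‖x‖ - ‖y‖) * ‖y‖⁻¹) • y‖ :=
        (congrArg norm this).trans_le (_root_.norm_sub_le _ _)
      _ = ‖x - y‖ + |‖x‖ - ‖y‖| := by
          rw [norm_smul, norm_mul, norm_inv, norm_norm, mul_assoc, inv_mul_cancel₀ hy0.ne', mul_one,
            Real.norm_eq_abs]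
      _ ≤ 2 * ‖x - y‖ := by linarith
  have h2 := hu.norm_sub_le (hsph hx) (hsph hy)
  have hdecomp : ‖x‖ • u (‖x‖⁻¹ • x) - ‖y‖ • u (‖y‖⁻¹ • y) =
      ‖x‖ • (u (‖x‖⁻¹ • x) - u (‖y‖⁻¹ • y)) + (‖x‖ - ‖y‖) • u (‖y‖⁻¹ • y) := by
    rw [smul_sub, sub_smul]; abel
  calc ‖‖x‖ • u (‖x‖⁻¹ • x) - ‖y‖ • u (‖y‖⁻¹ • y)‖
      ≤ ‖x‖ * ‖u (‖x‖⁻¹ • x) - u (‖y‖⁻¹ • y)‖ + |‖x‖ - ‖y‖| := by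
        rw [hdecomp]
        refine (norm_add_le _ _).trans_eq ?_
        rw [norm_smul, norm_smul, hnorm _ (hsph hy), norm_norm, mul_one, Real.norm_eq_abs]
    _ ≤ ‖x‖ * (K * ‖‖x‖⁻¹ • x - ‖y‖⁻¹ • y‖) + ‖x - y‖ := by gcongr
    _ = K * (‖x‖ * ‖‖x‖⁻¹ • x - ‖y‖⁻¹ • y‖) + ‖x - y‖ := by ring
    _ ≤ K * (2 * ‖x - y‖) + ‖x - y‖ := by gcongr
    _ = ↑(2 * K + 1) * ‖x - y‖ := by push_cast; ring

variable [FiniteDimensional ℝ E]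

open MeasureTheory in
/-- A Lipschitz vector field tangent to all spheres around the origin, with `‖w x‖ = ‖x‖`, exists
only in even dimension: for large `s`, the map `x ↦ s • x - w x` sends the unit ball onto the ball
of radius `√(s ^ 2 + 1)`, and the volume of the image is a polynomial in `s`. -/
theorem LipschitzWith.even_finrank_of_inner_eq_zero {w : E → E} {L : ℝ≥0} (hw : LipschitzWith L w)
    (hdiff : ∀ x ≠ 0, DifferentiableAt ℝ w x) (hinner : ∀ x, inner ℝ x (w x) = 0)
    (hnorm : ∀ x, ‖w x‖ = ‖x‖) : Even (Module.finrank ℝ E) := by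
  rcases subsingleton_or_nontrivial E with _ | _
  · simp [Module.finrank_zero_of_subsingleton]
  let : MeasurableSpace E := borel E
  have : BorelSpace E := ⟨rfl⟩
  let S : Set E := Metric.ball 0 1 \ {0}
  have hS : MeasurableSet S := Metric.isOpen_ball.measurableSet.diff (measurableSet_singleton 0)
  let P : E → Polynomial ℝ := fun x => (fderiv ℝ w x : E →ₗ[ℝ] E).charpoly
  let f' : ℝ → E → E →L[ℝ] E := fun s x => s • ContinuousLinearMap.id ℝ E - fderiv ℝ w x
  have hdet (s : ℝ) (hs : s > L) (x : E) : |(f' s x).det| = (P x).eval s := by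
    have h : (f' s x).det = (P x).eval s := by
      simp only [P, LinearMap.eval_charpoly, ContinuousLinearMap.det, f']
      congr 1
    rw [h, abs_of_pos]
    exact ContinuousLinearMap.charpoly_eval_pos _
      ((norm_fderiv_le_of_lipschitz ℝ hw).trans_lt hs)
  have hf' (s : ℝ) : ∀ x ∈ S, HasFDerivWithinAt (fun x => s • x - w x) (f' s x) S x := fun x hx =>
    (((hasFDerivAt_id x).const_smul s).sub (hdiff x hx.2).hasFDerivAt).hasFDerivWithinAt
  have himage (s : ℝ) (hs : s > L) :
      (fun x => s • x - w x) '' S = Metric.ball 0 √(s ^ 2 + 1) \ {0} := by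
    have hfn (x : E) : ‖s • x - w x‖ = √(s ^ 2 + 1) * ‖x‖ :=
      norm_smul_sub_of_inner_eq_zero (hinner x) (hnorm x) s
    have hpos : 0 < √(s ^ 2 + 1) := by positivity
    have hmem (x : E) : s • x - w x ∈ Metric.ball 0 √(s ^ 2 + 1) \ {0} ↔ x ∈ S := by
      simp only [S, Set.mem_sdiff, mem_ball_zero_iff, Set.mem_singleton_iff]
      rw [← norm_eq_zero, hfn, ← norm_eq_zero (a := x)]
      simp [hpos.ne', hpos]
    ext y
    obtain ⟨x, rfl⟩ := (hw.bijective_smul_sub hs).surjective y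
    rw [hmem, (hw.bijective_smul_sub hs).injective.mem_set_image]
  have hinj (s : ℝ) (hs : s > L) : Set.InjOn (fun x => s • x - w x) S :=
    (hw.bijective_smul_sub hs).injective.injOn
  obtain ⟨p, hp⟩ := exists_polynomial_eval_eq_integral (μ := volume.restrict S) (P := P) (L := L)
    (fun x => (LinearMap.charpoly_natDegree _).le) fun s hs => by
      have h := (integrableOn_image_iff_integrableOn_abs_det_fderiv_smul volume hS (hf' s)
        (hinj s hs) fun _ => (1 : ℝ)).1 (by
          rw [himage s hs, integrableOn_const_iff]
          exact Or.inr ((measure_mono Set.sdiff_subset).trans_lt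
            Metric.isBounded_ball.measure_lt_top))
      simpa [IntegrableOn, hdet s hs] using h
  refine Polynomial.even_of_eval_eq_mul_sqrt_pow (p := p) (L := L)
    (c := volume.real (Metric.ball (0 : E) 1)) ?_ fun s hs => ?_
  · exact (ENNReal.toReal_pos (Metric.measure_ball_pos _ _ one_pos).ne'
      Metric.isBounded_ball.measure_lt_top.ne).ne'
  · have h := integral_image_eq_integral_abs_det_fderiv_smul volume hS (hf' s)
      (hinj s hs) fun _ => (1 : ℝ)
    simp only [hdet s hs, himage s hs, smul_eq_mul, mul_one] at h
    rw [hp s hs, ← h]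
    simp only [integral_const, smul_eq_mul, mul_one, measureReal_def]
    rw [Measure.restrict_apply_univ, measure_sdiff_null (measure_singleton _),
      Measure.addHaar_ball _ _ (Real.sqrt_nonneg _),
      ENNReal.toReal_mul, ENNReal.toReal_ofReal (by positivity), mul_comm]

/-- A `C¹` vector field that is tangent to the unit sphere and vanishes nowhere on it exists only
in even dimension. -/
theorem even_finrank_of_contDiff_tangent_field {q : E → E} (hq : ContDiff ℝ 1 q)
    (hinner : ∀ x ∈ Metric.sphere (0 : E) 1, inner ℝ x (q x) = 0)
    (hne : ∀ x ∈ Metric.sphere (0 : E) 1, q x ≠ 0) : Even (Module.finrank ℝ E) := by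
  let u : E → E := fun x => ‖q x‖⁻¹ • q x
  have hsph {x : E} (hx : x ≠ 0) : ‖x‖⁻¹ • x ∈ Metric.sphere (0 : E) 1 := by
    simp [norm_smul, hx]
  have hnorm : ∀ x ∈ Metric.sphere (0 : E) 1, ‖u x‖ = 1 := fun x hx => by
    simp [u, norm_smul, hne x hx]
  have hcd : ∀ x ∈ Metric.sphere (0 : E) 1, ContDiffAt ℝ 1 u x := fun x hx =>
    ((hq.contDiffAt.norm ℝ (hne x hx)).inv (norm_ne_zero_iff.2 (hne x hx))).smul hq.contDiffAt
  obtain ⟨K, hK⟩ : ∃ K, LipschitzOnWith K u (Metric.sphere 0 1) :=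
    LocallyLipschitzOn.exists_lipschitzOnWith_of_compact (isCompact_sphere 0 1) fun x hx => by
      obtain ⟨K, t, ht, hKt⟩ := (hcd x hx).exists_lipschitzOnWith
      exact ⟨K, t, mem_nhdsWithin_of_mem_nhds ht, hKt⟩
  refine (hK.norm_smul_normalize hnorm).even_finrank_of_inner_eq_zero (fun x hx => ?_)
    (fun x => ?_) fun x => ?_
  · have h1 : DifferentiableAt ℝ (fun x : E => ‖x‖) x := differentiableAt_id.norm ℝ hx
    have h2 : DifferentiableAt ℝ (fun x : E => ‖x‖⁻¹ • x) x :=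
      (h1.inv (norm_ne_zero_iff.2 hx)).smul differentiableAt_id
    exact h1.smul (((hcd _ (hsph hx)).differentiableAt one_ne_zero).comp (g := u)
      (f := fun x : E => ‖x‖⁻¹ • x) x h2)
  · rcases eq_or_ne x 0 with rfl | hx
    · simp
    · have h := hinner _ (hsph hx)
      rw [inner_smul_left] at h
      have h' : inner ℝ x (q (‖x‖⁻¹ • x)) = 0 := by simpa [hx] using h
      simp [u, inner_smul_right, h']
  · rcases eq_or_ne x 0 with rfl | hx
    · simp
    · rw [norm_smul, hnorm _ (hsph hx), norm_norm, mul_one]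

/-- The **hairy ball theorem**: a continuous nowhere vanishing tangent vector field on the unit
sphere exists only in even dimension. -/
theorem even_finrank_of_continuous_tangent_field {v : Metric.sphere (0 : E) 1 → E}
    (hv : Continuous v) (hinner : ∀ x : Metric.sphere (0 : E) 1, inner ℝ (x : E) (v x) = 0)
    (hne : ∀ x, v x ≠ 0) :
    Even (Module.finrank ℝ E) := by
  obtain ⟨V, hV⟩ := ContinuousMap.exists_restrict_eq Metric.isClosed_sphere
    (⟨v, hv⟩ : C(Metric.sphere (0 : E) 1, E))
  have hV' (x : Metric.sphere (0 : E) 1) : V x = v x := congrArg (fun f => f x) hV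
  obtain ⟨m, hm, hmv⟩ : ∃ m > 0, ∀ x, m ≤ ‖v x‖ := by
    rcases isEmpty_or_nonempty (Metric.sphere (0 : E) 1) with _ | _
    · exact ⟨1, one_pos, fun x => isEmptyElim x⟩
    · obtain ⟨x₀, -, hx₀⟩ := isCompact_univ.exists_isMinOn Set.univ_nonempty hv.norm.continuousOn
      exact ⟨‖v x₀‖, norm_pos_iff.2 (hne x₀), fun x => hx₀ (Set.mem_univ x)⟩
  obtain ⟨g, hg, hgV, -⟩ := V.continuous.exists_contDiff_approx 1 (ε := fun _ => m)
    continuous_const fun _ => hm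
  refine even_finrank_of_contDiff_tangent_field (q := fun x => g x - inner ℝ x (g x) • x)
    (by exact hg.sub ((contDiff_id.inner ℝ hg).smul contDiff_id)) (fun x hx => ?_) fun x hx h0 => ?_
  · rw [inner_sub_right, inner_smul_right, real_inner_self_eq_norm_sq, mem_sphere_zero_iff_norm.1 hx]
    ring
  · have h1 := hgV x
    have h2 := hV' ⟨x, hx⟩
    have h3 := hinner ⟨x, hx⟩
    have h4 := hmv ⟨x, hx⟩
    simp only at h2 h3
    rw [← h2] at h3 h4
    have h5 : inner ℝ (g x) (V x) = 0 := by
      rw [sub_eq_zero.1 h0, inner_smul_left, h3, mul_zero]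
    rw [dist_eq_norm] at h1
    have h6 := norm_sub_sq_real (g x) (V x)
    rw [h5] at h6
    nlinarith [norm_nonneg (g x - V x), sq_nonneg ‖g x‖]

/-- A continuous self-map of an even-dimensional sphere that sends no point to its antipode has a
fixed point. -/
theorem exists_fixedPoint_of_ne_neg (hodd : Odd (Module.finrank ℝ E))
    {f : Metric.sphere (0 : E) 1 → Metric.sphere (0 : E) 1} (hf : Continuous f)
    (hneg : ∀ x, f x ≠ -x) : ∃ x, f x = x := by
  by_contra! hfix
  have hf' : Continuous fun x => (f x : E) := continuous_subtype_val.comp hf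
  refine Nat.not_even_iff_odd.2 hodd (even_finrank_of_continuous_tangent_field
    (v := fun x => (f x : E) - inner ℝ (x : E) (f x : E) • (x : E)) ?_ (fun x => ?_) fun x h0 => ?_)
  · exact hf'.sub ((continuous_subtype_val.inner hf').smul continuous_subtype_val)
  · rw [inner_sub_right, inner_smul_right, real_inner_self_eq_norm_sq,
      mem_sphere_zero_iff_norm.1 x.2]
    ring
  · have h1 := sub_eq_zero.1 h0
    have h2 := congrArg norm h1
    rw [norm_smul, mem_sphere_zero_iff_norm.1 x.2, mem_sphere_zero_iff_norm.1 (f x).2, mul_one,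
      Real.norm_eq_abs, eq_comm, abs_eq zero_le_one] at h2
    rcases h2 with h2 | h2
    · exact hfix x (Subtype.ext (by rw [h1, h2, one_smul]))
    · exact hneg x (Subtype.ext (by rw [h1, h2, neg_one_smul]; rfl))

end Sphere

/-- A continuous semiflow on a space homeomorphic to an even-dimensional sphere `S^{2n}`
has a fixed point. -/
theorem semiflow_even_sphere_has_fixed_point
    {Z : Type*} [TopologicalSpace Z] (n : ℕ) (hn : 1 ≤ n)
    (hZ : Nonempty (Z ≃ₜ Metric.sphere (0 : EuclideanSpace ℝ (Fin (2 * n + 1))) 1))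
    (Φ : Z × ℝ≥0 → Z) (hΦ : Continuous Φ)
    (h0 : ∀ z : Z, Φ (z, 0) = z)
    (hadd : ∀ (z : Z) (s t : ℝ≥0), Φ (Φ (z, s), t) = Φ (z, s + t)) :
    ∃ z : Z, ∀ t : ℝ≥0, Φ (z, t) = z := by
  obtain ⟨e⟩ := hZ
  have : CompactSpace Z := e.symm.compactSpace
  have : T2Space Z := e.symm.t2Space
  have hmul (z : Z) (s : ℝ≥0) (h : Φ (z, s) = z) (k : ℕ) : Φ (z, k * s) = z := by
    induction k with
    | zero => simpa using h0 z
    | succ k ih => rw [Nat.cast_succ, add_one_mul, ← hadd, ih, h]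
  have hsmall : ∀ᶠ t in 𝓝 (0 : ℝ≥0), ∃ z, Φ (z, t) = z := by
    have hopen : IsOpen {p : Z × ℝ≥0 | e (Φ p) ≠ -e p.1} :=
      isOpen_ne_fun (e.continuous.comp hΦ) (e.continuous.comp continuous_fst).neg
    have hev : ∀ᶠ t in 𝓝 (0 : ℝ≥0), ∀ z ∈ (Set.univ : Set Z), e (Φ (z, t)) ≠ -e z := by
      refine isCompact_univ.eventually_forall_of_forall_eventually fun z _ => ?_
      refine (hopen.preimage continuous_swap).mem_nhds ?_
      simpa [h0] using ne_neg_of_mem_unit_sphere ℝ (e z)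
    filter_upwards [hev] with t ht
    obtain ⟨x, hx⟩ := exists_fixedPoint_of_ne_neg (f := fun x => e (Φ (e.symm x, t)))
      (by simp) (by fun_prop) fun x => by simpa using ht (e.symm x) trivial
    exact ⟨e.symm x, e.injective (by simpa using hx)⟩
  have hdyadic : Tendsto (fun k : ℕ => (2⁻¹ : ℝ≥0) ^ k) atTop (𝓝 0) :=
    NNReal.tendsto_pow_atTop_nhds_zero_of_lt_one (by norm_num)
  obtain ⟨N, hN⟩ := eventually_atTop.1 (hdyadic.eventually hsmall)
  let F : ℕ → Set Z := fun k => {z | Φ (z, 2⁻¹ ^ (N + k)) = z}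
  have hF (k : ℕ) : IsClosed (F k) := isClosed_eq (by fun_prop) continuous_id
  obtain ⟨z, hz⟩ := IsCompact.nonempty_iInter_of_sequence_nonempty_isCompact_isClosed F
    (fun k z hz => by
      have h := hmul z _ hz 2
      have : ((2 : ℕ) : ℝ≥0) * 2⁻¹ ^ (N + (k + 1)) = 2⁻¹ ^ (N + k) := by
        rw [← add_assoc, pow_succ']; simp
      rwa [this] at h)
    (fun k => hN _ (N.le_add_right k)) (hF 0).isCompact hF
  refine ⟨z, fun t => ?_⟩
  let s : ℕ → ℝ≥0 := fun k => 2⁻¹ ^ (N + k)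
  have hs0 (k : ℕ) : 0 < s k := by positivity
  have hs : Tendsto s atTop (𝓝 0) :=
    hdyadic.comp (tendsto_add_atTop_nat N |>.congr fun k => add_comm k N)
  have hlim : Tendsto (fun k => (⌊t / s k⌋₊ : ℝ≥0) * s k) atTop (𝓝 t) := by
    have hlow : Tendsto (fun k => t - s k) atTop (𝓝 t) := by
      simpa using (tendsto_const_nhds (x := t)).sub hs
    refine tendsto_of_tendsto_of_tendsto_of_le_of_le hlow tendsto_const_nhds
      (fun k => ?_) fun k => ?_
    · rw [tsub_le_iff_right, ← add_one_mul, ← div_le_iff₀ (hs0 k)]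
      exact (Nat.lt_floor_add_one _).le
    · exact (le_div_iff₀ (hs0 k)).1 (Nat.floor_le (by positivity))
  have hΦz : Continuous fun r => Φ (z, r) := by fun_prop
  refine tendsto_nhds_unique ((hΦz.tendsto t).comp hlim) (tendsto_const_nhds.congr fun k => ?_)
  exact (hmul z _ (Set.mem_iInter.1 hz k) _).symm
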